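/- arXiv:1810.01131 — 3 statements merged into one kernel-verified Lean document; each statement's English description precedes it below -/
import Mathlib

section
/- For every (k₁,…,kₙ) ∈ ℕⁿ: D Ũ_{k₁,k₂,…,kₙ} = 0 if k₁ = 0, and D Ũ_{k₁,k₂,…,kₙ} = Ũ_{k₁−1,k₂,…,kₙ} if k₁ > 0 (where Ũ_{k₁−1,k₂,…,kₙ} is defined by the analogous expansion of π_{n,g−1}, g = k₁+2k₂+⋯+nkₙ). -/
open MvPolynomial TensorProduct

noncomputable section

/-- The potenziante `π_{n,g} = ∑_{r₁+⋯+rₙ=g} λ₁^{r₁}⋯λₙ^{rₙ} ⊗ a_{r₁}⋯a_{rₙ}`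
as an element of `ℂ[λ₁,…,λₙ] ⊗_ℂ R`, where `R = ℂ[a₀,a₁,…] = MvPolynomial ℕ ℂ`. -/
def pot (n g : ℕ) : MvPolynomial (Fin n) ℂ ⊗[ℂ] MvPolynomial ℕ ℂ :=
  ∑ r ∈ Finset.Nat.antidiagonalTuple n g,
    (∏ i : Fin n, X i ^ r i) ⊗ₜ[ℂ] (∏ i : Fin n, X (r i))

/-- The tuples `(k₁,…,kₙ) ∈ ℕⁿ` with `k₁ + 2k₂ + ⋯ + nkₙ = g`. -/
def wtT (n g : ℕ) : Finset (Fin n → ℕ) :=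
  (Fintype.piFinset fun _ : Fin n => Finset.range (g + 1)).filter
    (fun k => ∑ i : Fin n, ((i : ℕ) + 1) * k i = g)

theorem Derivation.map_finset_prod {R A ι : Type*} [CommSemiring R] [CommSemiring A] [Algebra R A]
    [DecidableEq ι] (D : Derivation R A A) (s : Finset ι) (f : ι → A) :
    D (∏ i ∈ s, f i) = ∑ i ∈ s, (∏ j ∈ s.erase i, f j) * D (f i) := by
  induction s using Finset.induction_on with
  | empty => simp
  | insert a s ha ih =>
    rw [Finset.prod_insert ha, D.leibniz, ih, Finset.sum_insert ha, Finset.erase_insert ha,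
      smul_eq_mul, smul_eq_mul, Finset.mul_sum, add_comm]
    congr 1
    refine Finset.sum_congr rfl fun i hi => ?_
    have hia : a ≠ i := fun h => ha (h ▸ hi)
    rw [Finset.erase_insert_of_ne hia,
      Finset.prod_insert fun h => ha (Finset.mem_of_mem_erase h), mul_assoc]

/-- The dual functionals of the monomials in the elementary symmetric polynomials. -/
theorem exists_dual_prod_esymm_pow (n : ℕ) (k : Fin n → ℕ) :
    ∃ φ : MvPolynomial (Fin n) ℂ →ₗ[ℂ] ℂ, ∀ l : Fin n → ℕ,
      φ (∏ i : Fin n, esymm (Fin n) ℂ ((i : ℕ) + 1) ^ l i) = if l = k then 1 else 0 := by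
  have hinj : Function.Injective
      (aeval (R := ℂ) fun i : Fin n => esymm (Fin n) ℂ ((i : ℕ) + 1)) := by
    intro p q h
    apply esymmAlgHom_injective (σ := Fin n) ℂ (n := n) (by simp)
    exact Subtype.ext (by simpa only [esymmAlgHom_apply] using h)
  obtain ⟨ψ, hψ⟩ := LinearMap.exists_leftInverse_of_injective
    (aeval (R := ℂ) fun i : Fin n => esymm (Fin n) ℂ ((i : ℕ) + 1)).toLinearMap
    (LinearMap.ker_eq_bot.2 hinj)
  refine ⟨lcoeff ℂ (Finsupp.equivFunOnFinite.symm k) ∘ₗ ψ, fun l => ?_⟩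
  have hl : ψ (∏ i : Fin n, esymm (Fin n) ℂ ((i : ℕ) + 1) ^ l i) =
      monomial (Finsupp.equivFunOnFinite.symm l) 1 := by
    have h := LinearMap.congr_fun hψ (monomial (Finsupp.equivFunOnFinite.symm l) 1)
    rw [LinearMap.comp_apply, AlgHom.toLinearMap_apply, aeval_monomial,
      Finsupp.prod_fintype _ _ (by simp)] at h
    simpa using h
  simp [hl, coeff_monomial]

/-- Since `D` lowers indices, differentiating the `j`-th factor multiplies by `λⱼ`. -/
theorem sum_antidiagonalTuple_succ_erase_mul
    (D : Derivation ℂ (MvPolynomial ℕ ℂ) (MvPolynomial ℕ ℂ))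
    (hD0 : D (X 0) = 0) (hD : ∀ i : ℕ, D (X (i + 1)) = X i) (n g : ℕ) (j : Fin n) :
    ∑ r ∈ Finset.Nat.antidiagonalTuple n (g + 1), (∏ i : Fin n, (X i : MvPolynomial (Fin n) ℂ) ^ r i)
        ⊗ₜ[ℂ] ((∏ i ∈ Finset.univ.erase j, X (r i)) * D (X (r j))) =
      ∑ r ∈ Finset.Nat.antidiagonalTuple n g,
        (X j * ∏ i : Fin n, X i ^ r i) ⊗ₜ[ℂ] (∏ i : Fin n, X (r i)) := by
  symm
  refine Finset.sum_of_injOn (fun r => r + Pi.single j 1) (add_left_injective _).injOn ?_ ?_ ?_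
  · intro r hr
    simp only [Finset.mem_coe, Finset.Nat.mem_antidiagonalTuple] at hr ⊢
    simp [Finset.sum_add_distrib, hr]
  · intro r hr hr'
    rcases Nat.eq_zero_or_pos (r j) with h0 | hpos
    · simp [h0, hD0]
    · have hle : Pi.single j 1 ≤ r := by
        intro i
        by_cases hi : i = j
        · rw [hi, Pi.single_eq_same]; exact hpos
        · simp [hi]
      refine absurd ⟨r - Pi.single j 1, ?_, tsub_add_cancel_of_le hle⟩ hr'
      have hsum := Finset.Nat.mem_antidiagonalTuple.1 hr
      rw [← tsub_add_cancel_of_le hle] at hsum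
      simp only [Pi.add_apply, Finset.sum_add_distrib, Finset.sum_pi_single',
        Finset.mem_univ, if_true, Nat.add_right_cancel_iff] at hsum
      exact Finset.mem_coe.2 (Finset.Nat.mem_antidiagonalTuple.2 hsum)
  · intro r _
    congr 1
    · simp only [Pi.add_apply, pow_add, Finset.prod_mul_distrib]
      rw [mul_comm]
      congr 1
      rw [Finset.prod_eq_single j (fun i _ hi => by simp [hi]) (by simp)]
      simp
    · simp only [Pi.add_apply, Pi.single_eq_same, hD]
      rw [← Finset.prod_erase_mul _ _ (Finset.mem_univ j)]
      congr 1
      refine Finset.prod_congr rfl fun i hi => ?_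
      simp [Finset.ne_of_mem_erase hi]

theorem lTensor_pot
    (D : Derivation ℂ (MvPolynomial ℕ ℂ) (MvPolynomial ℕ ℂ)) (n g : ℕ) :
    (D : MvPolynomial ℕ ℂ →ₗ[ℂ] MvPolynomial ℕ ℂ).lTensor (MvPolynomial (Fin n) ℂ) (pot n g) =
      ∑ j : Fin n, ∑ r ∈ Finset.Nat.antidiagonalTuple n g, (∏ i : Fin n, X i ^ r i)
        ⊗ₜ[ℂ] ((∏ i ∈ Finset.univ.erase j, X (r i)) * D (X (r j))) := by
  rw [Finset.sum_comm]
  simp [pot, Derivation.map_finset_prod, tmul_sum]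

theorem lTensor_pot_zero
    (D : Derivation ℂ (MvPolynomial ℕ ℂ) (MvPolynomial ℕ ℂ)) (hD0 : D (X 0) = 0) (n : ℕ) :
    (D : MvPolynomial ℕ ℂ →ₗ[ℂ] MvPolynomial ℕ ℂ).lTensor (MvPolynomial (Fin n) ℂ) (pot n 0) =
      0 := by
  simp [lTensor_pot, Finset.Nat.antidiagonalTuple_zero_right, hD0]

/-- `(1 ⊗ D) π_{n,g+1} = (e₁ ⊗ 1) π_{n,g}`. -/
theorem lTensor_pot_succ
    (D : Derivation ℂ (MvPolynomial ℕ ℂ) (MvPolynomial ℕ ℂ))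
    (hD0 : D (X 0) = 0) (hD : ∀ i : ℕ, D (X (i + 1)) = X i) (n g : ℕ) :
    (D : MvPolynomial ℕ ℂ →ₗ[ℂ] MvPolynomial ℕ ℂ).lTensor (MvPolynomial (Fin n) ℂ)
        (pot n (g + 1)) =
      (LinearMap.mulLeft ℂ (esymm (Fin n) ℂ 1)).rTensor (MvPolynomial ℕ ℂ) (pot n g) := by
  rw [lTensor_pot]
  simp only [sum_antidiagonalTuple_succ_erase_mul D hD0 hD]
  rw [Finset.sum_comm]
  simp [pot, esymm_one, Finset.sum_mul, sum_tmul]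

theorem mem_wtT {n g : ℕ} {k : Fin n → ℕ} :
    k ∈ wtT n g ↔ ∑ i : Fin n, ((i : ℕ) + 1) * k i = g := by
  refine ⟨fun h => (Finset.mem_filter.1 h).2, fun h => Finset.mem_filter.2 ⟨?_, h⟩⟩
  refine Fintype.mem_piFinset.2 fun i => Finset.mem_range_succ_iff.2 ?_
  calc k i ≤ ((i : ℕ) + 1) * k i := Nat.le_mul_of_pos_left _ i.1.succ_pos
    _ ≤ ∑ i : Fin n, ((i : ℕ) + 1) * k i :=
      Finset.single_le_sum (f := fun i : Fin n => ((i : ℕ) + 1) * k i)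
        (fun _ _ => Nat.zero_le _) (Finset.mem_univ i)
    _ = g := h

theorem sum_weight_add_single {n : ℕ} (hn : 0 < n) (k : Fin n → ℕ) :
    ∑ i : Fin n, ((i : ℕ) + 1) * (k + Pi.single ⟨0, hn⟩ 1 : Fin n → ℕ) i =
      ∑ i : Fin n, ((i : ℕ) + 1) * k i + 1 := by
  simp only [Pi.add_apply, mul_add, Finset.sum_add_distrib]
  congr 1
  rw [Finset.sum_eq_single (⟨0, hn⟩ : Fin n) (fun i _ hi => by simp [hi]) (by simp)]
  simp

theorem esymm_one_mul_prod_esymm_pow {n : ℕ} (hn : 0 < n) (k : Fin n → ℕ) :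
    esymm (Fin n) ℂ 1 * ∏ i : Fin n, esymm (Fin n) ℂ ((i : ℕ) + 1) ^ k i =
      ∏ i : Fin n, esymm (Fin n) ℂ ((i : ℕ) + 1) ^ (k + Pi.single ⟨0, hn⟩ 1 : Fin n → ℕ) i := by
  simp only [Pi.add_apply, pow_add, Finset.prod_mul_distrib]
  rw [mul_comm]
  congr 1
  rw [Finset.prod_eq_single (⟨0, hn⟩ : Fin n) (fun i _ hi => by simp [hi]) (by simp)]
  simp

/-- if `π_{n,g} = ∑_k e₁^{k₁}⋯eₙ^{kₙ} ⊗ Ũ_{k₁,…,kₙ}` (unique expansion in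
the monomials in the elementary symmetric polynomials `eⱼ(λ₁,…,λₙ)`), then for the
derivation `D` (with `D a₀ = 0`, `D aᵢ = a_{i-1}`):
`D Ũ_{k₁,…,kₙ} = 0` if `k₁ = 0`, and `D Ũ_{k₁,…,kₙ} = Ũ_{k₁-1,k₂,…,kₙ}` if `k₁ > 0`. -/
theorem stmt6
    (D : Derivation ℂ (MvPolynomial ℕ ℂ) (MvPolynomial ℕ ℂ))
    (hD0 : D (X 0) = 0) (hD : ∀ i : ℕ, D (X (i + 1)) = X i)
    (n : ℕ) (hn : 0 < n) (U : (Fin n → ℕ) → MvPolynomial ℕ ℂ)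
    (hU : ∀ g : ℕ, pot n g =
      ∑ k ∈ wtT n g,
        (∏ i : Fin n, esymm (Fin n) ℂ ((i : ℕ) + 1) ^ k i) ⊗ₜ[ℂ] U k) :
    ∀ k : Fin n → ℕ,
      (k ⟨0, hn⟩ = 0 → D (U k) = 0) ∧
      (0 < k ⟨0, hn⟩ →
        D (U k) = U (Function.update k ⟨0, hn⟩ (k ⟨0, hn⟩ - 1))) := by
  intro k
  obtain ⟨φ, hφ⟩ := exists_dual_prod_esymm_pow n k
  let ev := (TensorProduct.lid ℂ (MvPolynomial ℕ ℂ)).toLinearMap ∘ₗ φ.rTensor (MvPolynomial ℕ ℂ)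
  have hev : ∀ (l : Fin n → ℕ) (u : MvPolynomial ℕ ℂ),
      ev ((∏ i : Fin n, esymm (Fin n) ℂ ((i : ℕ) + 1) ^ l i) ⊗ₜ[ℂ] u) =
        if l = k then u else 0 := by
    intro l u
    simp [ev, hφ]
  have hDU : ∀ g, k ∈ wtT n g → D (U k) = ev ((D : MvPolynomial ℕ ℂ →ₗ[ℂ] MvPolynomial ℕ ℂ).lTensor
      (MvPolynomial (Fin n) ℂ) (pot n g)) := by
    intro g hg
    simp only [hU, map_sum, LinearMap.lTensor_tmul, hev, Finset.sum_ite_eq', hg, if_true,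
      Derivation.coeFn_coe]
  have hsucc : ∀ g, ev ((D : MvPolynomial ℕ ℂ →ₗ[ℂ] MvPolynomial ℕ ℂ).lTensor
      (MvPolynomial (Fin n) ℂ) (pot n (g + 1))) =
      ∑ l ∈ wtT n g, if l + Pi.single ⟨0, hn⟩ 1 = k then U l else 0 := by
    intro g
    rw [lTensor_pot_succ D hD0 hD]
    simp only [hU, map_sum, LinearMap.rTensor_tmul,
      LinearMap.mulLeft_apply, esymm_one_mul_prod_esymm_pow hn, hev]
  constructor
  · intro hk
    obtain hg | ⟨g, hg⟩ : k ∈ wtT n 0 ∨ ∃ g, k ∈ wtT n (g + 1) := by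
      rcases h : ∑ i : Fin n, ((i : ℕ) + 1) * k i with _ | g
      · exact .inl (mem_wtT.2 h)
      · exact .inr ⟨g, mem_wtT.2 h⟩
    · rw [hDU 0 hg, lTensor_pot_zero D hD0, map_zero]
    · rw [hDU _ hg, hsucc]
      refine Finset.sum_eq_zero fun l _ => if_neg ?_
      rintro rfl
      simp at hk
  · intro hk
    set k' := Function.update k ⟨0, hn⟩ (k ⟨0, hn⟩ - 1) with hk'
    have hkk' : k' + Pi.single ⟨0, hn⟩ 1 = k := by
      ext i
      by_cases hi : i = ⟨0, hn⟩
      · subst hi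
        simp only [hk', Pi.add_apply, Function.update_self, Pi.single_eq_same]
        omega
      · simp [hk', hi]
    have hmem : k' ∈ wtT n (∑ i : Fin n, ((i : ℕ) + 1) * k' i) := mem_wtT.2 rfl
    rw [hDU _ (mem_wtT.2 (hkk' ▸ sum_weight_add_single hn k')), hsucc,
      Finset.sum_eq_single_of_mem k' hmem, if_pos hkk']
    intro l _ hl
    exact if_neg fun h => hl (add_left_injective _ (h.trans hkk'.symm))
end
end

section
/- For every n ≥ 1 and every g ∈ ℕ, the elements U_{k₂,…,kₙ} with (k₂,…,kₙ) ∈ ℕ^{n−1} and 2k₂+3k₃+⋯+nkₙ = g form a ℂ-basis of S_{n,g}. -/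
open MvPolynomial TensorProduct

noncomputable section

/-- `(k₂,…,kₙ) ↦ (0,k₂,…,kₙ)`. -/
def extend0 {n : ℕ} (k : Fin (n - 1) → ℕ) : Fin n → ℕ :=
  fun i => if h : 0 < (i : ℕ) then k ⟨(i : ℕ) - 1, by have := i.isLt; omega⟩ else 0

/-- `R_{n,g}`: the ℂ-span of the monomials of degree `n` and weight `g` in
`R = ℂ[a₀,a₁,…] = MvPolynomial ℕ ℂ` (with `aᵢ = X i`). -/
def Rng (n g : ℕ) : Submodule ℂ (MvPolynomial ℕ ℂ) :=
  Submodule.span ℂ {p : MvPolynomial ℕ ℂ | ∃ m : ℕ →₀ ℕ,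
    (m.sum fun _ e => e) = n ∧ (m.sum fun i e => i * e) = g ∧ p = monomial m 1}

/-- The contraction of the potenziante `π_{n,g}` with a linear functional `φ` on `ℂ[λ₁,…,λₙ]`. -/
def contract {n : ℕ} (φ : MvPolynomial (Fin n) ℂ →ₗ[ℂ] ℂ) (g : ℕ) : MvPolynomial ℕ ℂ :=
  ∑ r ∈ Finset.Nat.antidiagonalTuple n g, φ (∏ i, X i ^ r i) • ∏ i, X (r i)

/-- The product `e₁^{k₁}⋯eₙ^{kₙ}` of powers of elementary symmetric polynomials. -/
def esymmMonomial {n : ℕ} (k : Fin n → ℕ) : MvPolynomial (Fin n) ℂ :=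
  ∏ i : Fin n, esymm (Fin n) ℂ ((i : ℕ) + 1) ^ k i

theorem contract_eq_sum {n g : ℕ} {U : (Fin n → ℕ) → MvPolynomial ℕ ℂ}
    (hU : pot n g = ∑ k ∈ wtT n g, esymmMonomial k ⊗ₜ[ℂ] U k)
    (φ : MvPolynomial (Fin n) ℂ →ₗ[ℂ] ℂ) :
    contract φ g = ∑ k ∈ wtT n g, φ (esymmMonomial k) • U k := by
  have h := congrArg (fun t => TensorProduct.lid ℂ (MvPolynomial ℕ ℂ) (φ.rTensor _ t)) hU
  simpa [pot, contract] using h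

theorem prod_X_pow_eq_monomial_equivFunOnFinite {n : ℕ} (r : Fin n → ℕ) :
    (∏ i, X i ^ r i : MvPolynomial (Fin n) ℂ) =
      monomial (Finsupp.equivFunOnFinite.symm r) 1 := by
  rw [monomial_eq, Finsupp.prod_fintype _ _ (by simp)]
  simp

theorem prod_X_comp {n : ℕ} (r : Fin n → ℕ) :
    (∏ i, X (r i) : MvPolynomial ℕ ℂ) = monomial (∑ i, Finsupp.single (r i) 1) 1 := by
  simp only [X, ← monomial_sum_one]

theorem exists_perm_of_sum_single_eq {n : ℕ} {r s : Fin n → ℕ}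
    (h : ∑ i, Finsupp.single (r i) 1 = ∑ i, Finsupp.single (s i) 1) :
    ∃ σ : Equiv.Perm (Fin n), r = s ∘ σ := by
  have hcard (a : ℕ) : Fintype.card {i // r i = a} = Fintype.card {i // s i = a} := by
    have := DFunLike.congr_fun h a
    simpa [Finsupp.finsetSum_apply, Finsupp.single_apply, Fintype.card_subtype] using this
  exact ⟨Equiv.ofFiberEquiv fun a => Fintype.equivOfCardEq (hcard a),
    funext fun i => (Equiv.ofFiberEquiv_map _ i).symm⟩

theorem coeff_eq_of_isSymmetric {n : ℕ} {e : MvPolynomial (Fin n) ℂ} (he : e.IsSymmetric)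
    {r s : Fin n → ℕ} (h : ∑ i, Finsupp.single (r i) 1 = ∑ i, Finsupp.single (s i) 1) :
    coeff (Finsupp.equivFunOnFinite.symm r) e = coeff (Finsupp.equivFunOnFinite.symm s) e := by
  obtain ⟨σ, rfl⟩ := exists_perm_of_sum_single_eq h
  rw [← coeff_rename_mapDomain σ σ.injective e, he σ]
  congr 1
  ext i
  obtain ⟨j, rfl⟩ := σ.surjective i
  rw [Finsupp.mapDomain_apply σ.injective]
  simp

theorem sum_coeff_smul_monomial {n g : ℕ} {e : MvPolynomial (Fin n) ℂ} (he : e.IsHomogeneous g) :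
    e = ∑ r ∈ Finset.Nat.antidiagonalTuple n g,
      coeff (Finsupp.equivFunOnFinite.symm r) e • ∏ i, X i ^ r i := by
  ext d
  obtain ⟨d, rfl⟩ := Finsupp.equivFunOnFinite.symm.surjective d
  simp only [prod_X_pow_eq_monomial_equivFunOnFinite, coeff_sum, coeff_smul, coeff_monomial,
    EmbeddingLike.apply_eq_iff_eq, smul_eq_mul, mul_ite, mul_one, mul_zero, Finset.sum_ite_eq',
    Finset.Nat.mem_antidiagonalTuple]
  split_ifs with h
  · rfl
  · exact he.coeff_eq_zero (by simpa [Finsupp.degree_eq_sum] using h)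

/-- Pairing the right factor of the potenziante recovers every homogeneous symmetric polynomial. -/
theorem exists_functional_contract {n g : ℕ} {e : MvPolynomial (Fin n) ℂ} (hs : e.IsSymmetric)
    (he : e.IsHomogeneous g) :
    ∃ T : MvPolynomial ℕ ℂ →ₗ[ℂ] ℂ,
      ∀ φ : MvPolynomial (Fin n) ℂ →ₗ[ℂ] ℂ, T (contract φ g) = φ e := by
  let F : (ℕ →₀ ℕ) → ℂ := Function.extend
    (fun r : Fin n → ℕ => ∑ i, Finsupp.single (r i) 1)
    (fun r => coeff (Finsupp.equivFunOnFinite.symm r) e) 0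
  refine ⟨(basisMonomials ℕ ℂ).constr ℂ F, fun φ => ?_⟩
  have hF (r : Fin n → ℕ) : (basisMonomials ℕ ℂ).constr ℂ F (∏ i, X (r i)) =
      coeff (Finsupp.equivFunOnFinite.symm r) e := by
    have hb := congrFun (coe_basisMonomials ℕ ℂ) (∑ i, Finsupp.single (r i) 1)
    rw [prod_X_comp, ← hb, Module.Basis.constr_basis]
    exact Function.FactorsThrough.extend_apply
      (fun _ _ h => coeff_eq_of_isSymmetric hs h) 0 r
  conv_rhs => rw [sum_coeff_smul_monomial he]
  simp only [contract, map_sum, map_smul, hF, smul_eq_mul, mul_comm]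

theorem esymm_isHomogeneous {n : ℕ} (j : ℕ) : (esymm (Fin n) ℂ j).IsHomogeneous j := by
  refine IsHomogeneous.sum _ _ _ fun s hs => ?_
  rw [← (Finset.mem_powersetCard.1 hs).2, Finset.card_eq_sum_ones]
  exact IsHomogeneous.prod _ _ _ fun i _ => isHomogeneous_X ℂ i

theorem esymmMonomial_isHomogeneous {n : ℕ} (k : Fin n → ℕ) :
    (esymmMonomial k).IsHomogeneous (∑ i : Fin n, ((i : ℕ) + 1) * k i) :=
  IsHomogeneous.prod _ _ _ fun _ _ => (esymm_isHomogeneous _).pow _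

theorem esymmMonomial_isSymmetric {n : ℕ} (k : Fin n → ℕ) : (esymmMonomial k).IsSymmetric :=
  (symmetricSubalgebra (Fin n) ℂ).prod_mem fun _ _ =>
    (symmetricSubalgebra (Fin n) ℂ).pow_mem (esymm_isSymmetric _ _ _) _

theorem exists_dual_esymmMonomial {n : ℕ} (k : Fin n → ℕ) :
    ∃ φ : MvPolynomial (Fin n) ℂ →ₗ[ℂ] ℂ,
      ∀ l : Fin n → ℕ, φ (esymmMonomial l) = if l = k then 1 else 0 := by
  let E : MvPolynomial (Fin n) ℂ →ₐ[ℂ] MvPolynomial (Fin n) ℂ :=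
    aeval fun i : Fin n => esymm (Fin n) ℂ ((i : ℕ) + 1)
  have hE : Function.Injective E := fun p q h =>
    esymmAlgHom_fin_injective ℂ le_rfl (Subtype.ext (by
      simpa only [esymmAlgHom_apply] using h))
  obtain ⟨G, hG⟩ := E.toLinearMap.exists_leftInverse_of_injective (LinearMap.ker_eq_bot.2 hE)
  refine ⟨lcoeff ℂ (Finsupp.equivFunOnFinite.symm k) ∘ₗ G, fun l => ?_⟩
  have hl : esymmMonomial l = E.toLinearMap (monomial (Finsupp.equivFunOnFinite.symm l) 1) := by
    rw [← prod_X_pow_eq_monomial_equivFunOnFinite]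
    simp [E, esymmMonomial]
  rw [hl, LinearMap.comp_apply, ← LinearMap.comp_apply G, hG]
  simp [coeff_monomial]

theorem derivation_prod {ι : Type*} [DecidableEq ι]
    (D : Derivation ℂ (MvPolynomial ℕ ℂ) (MvPolynomial ℕ ℂ)) (s : Finset ι)
    (f : ι → MvPolynomial ℕ ℂ) :
    D (∏ i ∈ s, f i) = ∑ i ∈ s, (∏ j ∈ s.erase i, f j) * D (f i) := by
  induction s using Finset.induction_on with
  | empty => simp
  | insert a s ha ih =>
    rw [Finset.prod_insert ha, D.leibniz, ih, Finset.sum_insert ha, Finset.erase_insert ha,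
      add_comm, smul_eq_mul, smul_eq_mul, Finset.mul_sum]
    congr 1
    refine Finset.sum_congr rfl fun i hi => ?_
    have hai : a ≠ i := fun h => ha (h ▸ hi)
    rw [Finset.erase_insert_of_ne hai, Finset.prod_insert (by simp [ha]), mul_assoc]

section Derivation

variable {D : Derivation ℂ (MvPolynomial ℕ ℂ) (MvPolynomial ℕ ℂ)}

theorem derivation_contract_zero (hD0 : D (X 0) = 0) {n : ℕ}
    (φ : MvPolynomial (Fin n) ℂ →ₗ[ℂ] ℂ) : D (contract φ 0) = 0 := by
  simp [contract, Finset.Nat.antidiagonalTuple_zero_right, hD0]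

theorem derivation_contract_succ (hD0 : D (X 0) = 0) (hD : ∀ i : ℕ, D (X (i + 1)) = X i) {n : ℕ}
    (φ : MvPolynomial (Fin n) ℂ →ₗ[ℂ] ℂ) (g : ℕ) :
    D (contract φ (g + 1)) =
      contract (φ ∘ₗ LinearMap.mulLeft ℂ (esymm (Fin n) ℂ 1)) g := by
  classical
  simp only [contract, map_sum, Derivation.map_smul, derivation_prod, Finset.smul_sum,
    LinearMap.comp_apply, LinearMap.mulLeft_apply, esymm_one, Finset.sum_mul, Finset.sum_smul]
  rw [Finset.sum_comm]
  conv_rhs => rw [Finset.sum_comm]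
  refine Finset.sum_congr rfl fun i _ => ?_
  symm
  refine Finset.sum_of_injOn (fun r => r + Pi.single i 1) (fun r _ s _ h => by simpa using h)
    ?_ ?_ ?_
  · intro r hr
    simp_all [Finset.Nat.mem_antidiagonalTuple, Finset.sum_add_distrib]
  · intro r hr hr'
    have h0 : r i = 0 := by
      by_contra h0
      refine hr' ⟨r - Pi.single i 1, ?_, ?_⟩
      all_goals
        have hle : Pi.single i 1 ≤ r := by
          intro j
          rcases eq_or_ne j i with rfl | hj
          · simpa using Nat.one_le_iff_ne_zero.2 h0
          · simp [hj]
      · have h1 := tsub_add_cancel_of_le hle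
        rw [← h1] at hr
        simpa [Finset.Nat.mem_antidiagonalTuple, Finset.sum_add_distrib] using hr
      · exact tsub_add_cancel_of_le hle
    simp [h0, hD0]
  · intro r _
    have hr :
        ∏ j ∈ Finset.univ.erase i, (X ((r + Pi.single i 1 : Fin n → ℕ) j) : MvPolynomial ℕ ℂ) =
        ∏ j ∈ Finset.univ.erase i, X (r j) :=
      Finset.prod_congr rfl fun j hj => by simp [Finset.ne_of_mem_erase hj]
    have hX : (∏ j, X j ^ (r + Pi.single i 1 : Fin n → ℕ) j : MvPolynomial (Fin n) ℂ) =
        X i * ∏ j, X j ^ r j := by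
      simp only [Pi.add_apply, pow_add, Finset.prod_mul_distrib]
      simp [Pi.single_apply, mul_comm]
    rw [hr, hX, Pi.add_apply, Pi.single_eq_same, hD, Finset.prod_erase_mul _ _ (Finset.mem_univ i)]

end Derivation

theorem contract_mem_Rng {n : ℕ} (φ : MvPolynomial (Fin n) ℂ →ₗ[ℂ] ℂ) (g : ℕ) :
    contract φ g ∈ Rng n g := by
  refine Submodule.sum_mem _ fun r hr => Submodule.smul_mem _ _ (Submodule.subset_span ?_)
  rw [Finset.Nat.mem_antidiagonalTuple] at hr
  refine ⟨∑ i, Finsupp.single (r i) 1, ?_, ?_, prod_X_comp r⟩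
  · rw [← Finsupp.sum_finsetSum_index (by simp) (by simp)]
    simp
  · rw [← Finsupp.sum_finsetSum_index (by simp) (by intros; ring)]
    simpa using hr

theorem exists_eq_sum_single (m : ℕ →₀ ℕ) {n : ℕ} (hm : (m.sum fun _ e => e) = n) :
    ∃ r : Fin n → ℕ, m = ∑ i, Finsupp.single (r i) 1 := by
  obtain ⟨l, hl⟩ := Quot.exists_rep (Finsupp.toMultiset m)
  change (l : Multiset ℕ) = _ at hl
  have hc : l.length = n := by
    rw [← Multiset.coe_card, hl, Finsupp.card_toMultiset]
    exact hm
  subst hc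
  refine ⟨l.get, Multiset.toFinsupp.symm.injective
    (?_ : Finsupp.toMultiset _ = Finsupp.toMultiset _)⟩
  rw [← hl, map_sum]
  simp only [Finsupp.toMultiset_single, one_smul, List.get_eq_getElem]
  rw [Fin.sum_univ_fun_getElem l fun a => ({a} : Multiset ℕ), ← Multiset.sum_coe,
    ← Multiset.map_coe, Multiset.sum_map_singleton]

theorem exists_eq_contract {n g : ℕ} {x : MvPolynomial ℕ ℂ} (hx : x ∈ Rng n g) :
    ∃ φ : MvPolynomial (Fin n) ℂ →ₗ[ℂ] ℂ, x = contract φ g := by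
  induction hx using Submodule.span_induction with
  | mem x hx =>
    obtain ⟨m, hn, hg, rfl⟩ := hx
    obtain ⟨s, rfl⟩ := exists_eq_sum_single m hn
    refine ⟨lcoeff ℂ (Finsupp.equivFunOnFinite.symm s), ?_⟩
    have hs : s ∈ Finset.Nat.antidiagonalTuple n g := by
      rw [← Finsupp.sum_finsetSum_index (by simp) (by intros; ring)] at hg
      simpa [Finset.Nat.mem_antidiagonalTuple] using hg
    simp [contract, prod_X_pow_eq_monomial_equivFunOnFinite, coeff_monomial, hs, prod_X_comp]
  | zero => exact ⟨0, by simp [contract]⟩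
  | add x y _ _ hx hy =>
    obtain ⟨φ, rfl⟩ := hx
    obtain ⟨ψ, rfl⟩ := hy
    exact ⟨φ + ψ, by simp [contract, add_smul, Finset.sum_add_distrib]⟩
  | smul c x _ hx =>
    obtain ⟨φ, rfl⟩ := hx
    exact ⟨c • φ, by simp [contract, mul_smul, Finset.smul_sum]⟩

theorem extend0_succ {m : ℕ} (k : Fin (m + 1 - 1) → ℕ) :
    (extend0 k : Fin (m + 1) → ℕ) = Fin.cons 0 k := by
  ext i
  refine Fin.cases ?_ (fun j => ?_) i <;> simp [extend0]

theorem sum_cons_zero {m : ℕ} (k : Fin m → ℕ) :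
    ∑ i : Fin (m + 1), ((i : ℕ) + 1) * (Fin.cons 0 k : Fin (m + 1) → ℕ) i =
      ∑ i : Fin m, ((i : ℕ) + 2) * k i := by
  simp [Fin.sum_univ_succ, add_assoc]

theorem esymm_one_mul_esymmMonomial_cons {m : ℕ} (a : ℕ) (k : Fin m → ℕ) :
    esymm (Fin (m + 1)) ℂ 1 * esymmMonomial (Fin.cons a k : Fin (m + 1) → ℕ) =
      esymmMonomial (Fin.cons (a + 1) k : Fin (m + 1) → ℕ) := by
  simp [esymmMonomial, Fin.prod_univ_succ, pow_succ']
  ring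

/-- given the unique expansion
`π_{n,g} = ∑_k e₁^{k₁}⋯eₙ^{kₙ} ⊗ Ũ_{k₁,…,kₙ}` and setting `U_{k₂,…,kₙ} := Ũ_{0,k₂,…,kₙ}`,
the elements `U_{k₂,…,kₙ}` with `2k₂+3k₃+⋯+nkₙ = g` form a ℂ-basis of
`S_{n,g} = (ker D) ∩ R_{n,g}`. -/
theorem stmt7
    (D : Derivation ℂ (MvPolynomial ℕ ℂ) (MvPolynomial ℕ ℂ))
    (hD0 : D (X 0) = 0) (hD : ∀ i : ℕ, D (X (i + 1)) = X i)
    (n : ℕ) (hn : 1 ≤ n) (U : (Fin n → ℕ) → MvPolynomial ℕ ℂ)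
    (hU : ∀ g : ℕ, pot n g =
      ∑ k ∈ wtT n g,
        (∏ i : Fin n, esymm (Fin n) ℂ ((i : ℕ) + 1) ^ k i) ⊗ₜ[ℂ] U k)
    (g : ℕ) :
    LinearIndependent ℂ
      (fun k : {k : Fin (n - 1) → ℕ // ∑ i : Fin (n - 1), ((i : ℕ) + 2) * k i = g} =>
        U (extend0 k.val)) ∧
    Submodule.span ℂ
        {x : MvPolynomial ℕ ℂ |
          ∃ k : Fin (n - 1) → ℕ, (∑ i : Fin (n - 1), ((i : ℕ) + 2) * k i = g) ∧ x = U (extend0 k)} =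
      LinearMap.ker (D : MvPolynomial ℕ ℂ →ₗ[ℂ] MvPolynomial ℕ ℂ) ⊓ Rng n g := by
  obtain ⟨m, rfl⟩ : ∃ m, n = m + 1 := ⟨n - 1, by omega⟩
  have key (g : ℕ) := contract_eq_sum (hU g)
  have dual (k : Fin (m + 1) → ℕ) {g : ℕ} (hk : ∑ i : Fin (m + 1), ((i : ℕ) + 1) * k i = g) :
      ∃ φ : MvPolynomial (Fin (m + 1)) ℂ →ₗ[ℂ] ℂ, U k = contract φ g ∧
        ∀ l : Fin (m + 1) → ℕ, φ (esymmMonomial l) = if l = k then 1 else 0 := by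
    obtain ⟨φ, hφ⟩ := exists_dual_esymmMonomial k
    exact ⟨φ, by simp [key, hφ, mem_wtT.2 hk], hφ⟩
  simp only [extend0_succ]
  refine ⟨?_, le_antisymm (Submodule.span_le.2 ?_) ?_⟩
  · rw [linearIndependent_iff']
    intro s c hc k hk
    have hkg := (sum_cons_zero k.1).trans k.2
    obtain ⟨T, hT⟩ := exists_functional_contract
      (esymmMonomial_isSymmetric (Fin.cons 0 k.1 : Fin (m + 1) → ℕ))
      (hkg ▸ esymmMonomial_isHomogeneous (Fin.cons 0 k.1 : Fin (m + 1) → ℕ))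
    have hTU (l : {k : Fin m → ℕ // ∑ i : Fin m, ((i : ℕ) + 2) * k i = g}) :
        T (U (Fin.cons 0 l.1)) = if k = l then 1 else 0 := by
      obtain ⟨φ, h1, h2⟩ := dual (Fin.cons 0 l.1) ((sum_cons_zero l.1).trans l.2)
      rw [h1, hT, h2]
      simp [Subtype.ext_iff]
    have h := congrArg T hc
    simp only [map_sum, map_smul, map_zero] at h
    rw [Finset.sum_congr rfl fun l _ => by rw [hTU l]] at h
    simpa [hk] using h
  · rintro _ ⟨k, hk, rfl⟩
    obtain ⟨φ, h1, h2⟩ := dual (Fin.cons 0 k) ((sum_cons_zero k).trans hk)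
    refine ⟨?_, h1 ▸ contract_mem_Rng φ g⟩
    change D (U (Fin.cons 0 k)) = 0
    rw [h1]
    cases g with
    | zero => exact derivation_contract_zero hD0 φ
    | succ g =>
      rw [derivation_contract_succ hD0 hD, key]
      refine Finset.sum_eq_zero fun l _ => ?_
      obtain ⟨a, l, rfl⟩ : ∃ a l', l = Fin.cons a l' :=
        ⟨l 0, Fin.tail l, (Fin.cons_self_tail l).symm⟩
      rw [LinearMap.comp_apply, LinearMap.mulLeft_apply, esymm_one_mul_esymmMonomial_cons, h2,
        if_neg (by simp [Fin.cons_inj]), zero_smul]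
  · rintro x ⟨hxD, hx⟩
    obtain ⟨φ, rfl⟩ := exists_eq_contract hx
    replace hxD : D (contract φ g) = 0 := hxD
    have hφ (a : ℕ) (l : Fin m → ℕ)
        (hl : ∑ i : Fin (m + 1), ((i : ℕ) + 1) * (Fin.cons (a + 1) l : Fin (m + 1) → ℕ) i = g) :
        φ (esymmMonomial (Fin.cons (a + 1) l : Fin (m + 1) → ℕ)) = 0 := by
      obtain ⟨g, rfl⟩ : ∃ g', g = g' + 1 := by
        refine ⟨g - 1, ?_⟩
        simp [Fin.sum_univ_succ] at hl
        omega
      rw [derivation_contract_succ hD0 hD] at hxD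
      have hl' : ∑ i : Fin (m + 1), ((i : ℕ) + 1) * (Fin.cons a l : Fin (m + 1) → ℕ) i = g := by
        simp [Fin.sum_univ_succ] at hl ⊢
        omega
      obtain ⟨T, hT⟩ := exists_functional_contract
        (esymmMonomial_isSymmetric (Fin.cons a l : Fin (m + 1) → ℕ))
        (hl' ▸ esymmMonomial_isHomogeneous (Fin.cons a l : Fin (m + 1) → ℕ))
      rw [← esymm_one_mul_esymmMonomial_cons]
      have h := hT (φ ∘ₗ LinearMap.mulLeft ℂ (esymm (Fin (m + 1)) ℂ 1))
      rw [hxD, map_zero] at h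
      exact h.symm
    rw [key]
    refine Submodule.sum_mem _ fun l hl => ?_
    rw [mem_wtT] at hl
    obtain ⟨a, l, rfl⟩ : ∃ a l', l = Fin.cons a l' :=
      ⟨l 0, Fin.tail l, (Fin.cons_self_tail l).symm⟩
    cases a with
    | zero =>
      exact Submodule.smul_mem _ _ (Submodule.subset_span ⟨l, (sum_cons_zero l).symm.trans hl, rfl⟩)
    | succ a => simp [hφ a l hl]
end
end

section
/- For n = 2h with h > 1, the element p_h = ∏_{T⊆{1,…,n}, |T|=h, 1∈T} λ̄_T of Aₙ is invariant under the Sₙ-action permuting λ̄₁,…,λ̄ₙ. -/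
open MvPolynomial

noncomputable section

/-- `λ̄ᵢ` (`i = 1,…,n`) in `Aₙ = ℂ[λ₁,…,λₙ]/(λ₁+⋯+λₙ)`, identified with the polynomial
ring `ℂ[λ̄₁,…,λ̄_{n-1}]` via `λ̄ₙ = −(λ̄₁+⋯+λ̄_{n-1})`. -/
def lamb (n : ℕ) (i : Fin n) : MvPolynomial (Fin (n - 1)) ℂ :=
  if h : (i : ℕ) < n - 1 then X ⟨(i : ℕ), h⟩ else -(∑ j : Fin (n - 1), X j)

/-- `λ̄_T := ∑_{i∈T} λ̄ᵢ` for a subset `T ⊆ {1,…,n}`. -/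
def lamT (n : ℕ) (T : Finset (Fin n)) : MvPolynomial (Fin (n - 1)) ℂ :=
  ∑ i ∈ T, lamb n i

/-- The induced `Sₙ`-action on `Aₙ ≅ ℂ[λ̄₁,…,λ̄_{n-1}]`, permuting `λ̄₁,…,λ̄ₙ`. -/
def permAct (n : ℕ) (σ : Equiv.Perm (Fin n)) :
    MvPolynomial (Fin (n - 1)) ℂ →ₐ[ℂ] MvPolynomial (Fin (n - 1)) ℂ :=
  aeval (fun j : Fin (n - 1) => lamb n (σ (Fin.castLE (Nat.sub_le n 1) j)))

theorem sum_lamb (n : ℕ) (hn : 0 < n) : ∑ i : Fin n, lamb n i = 0 := by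
  obtain ⟨m, rfl⟩ : ∃ m, n = m + 1 := ⟨n - 1, by lia⟩
  rw [Fin.sum_univ_castSucc]
  simp [lamb]

theorem permAct_lamb (n : ℕ) (hn : 0 < n) (σ : Equiv.Perm (Fin n)) (i : Fin n) :
    permAct n σ (lamb n i) = lamb n (σ i) := by
  obtain ⟨m, rfl⟩ : ∃ m, n = m + 1 := ⟨n - 1, by lia⟩
  have hcast : ∀ j : Fin m,
      permAct (m + 1) σ (X j) = lamb (m + 1) (σ j.castSucc) := fun j => by
    simp only [permAct]
    exact aeval_X _ _
  induction i using Fin.lastCases with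
  | cast j =>
    rw [← hcast j]
    simp [lamb]
  | last =>
    have hsum : ∑ i, lamb (m + 1) (σ i) = 0 :=
      (Equiv.sum_comp σ (lamb (m + 1))).trans (sum_lamb _ hn)
    rw [Fin.sum_univ_castSucc] at hsum
    have hlast : lamb (m + 1) (Fin.last m) = -∑ j : Fin m, X j := by simp [lamb]
    rw [hlast, map_neg, map_sum, eq_neg_of_add_eq_zero_right hsum]
    exact congrArg _ (Finset.sum_congr rfl fun j _ => hcast j)

theorem permAct_lamT (n : ℕ) (hn : 0 < n) (σ : Equiv.Perm (Fin n)) (T : Finset (Fin n)) :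
    permAct n σ (lamT n T) = lamT n (T.map σ.toEmbedding) := by
  simp [lamT, permAct_lamb n hn]

theorem lamT_compl (n : ℕ) (hn : 0 < n) (T : Finset (Fin n)) :
    lamT n Tᶜ = -lamT n T := by
  refine eq_neg_of_add_eq_zero_left ?_
  rw [lamT, lamT, Finset.sum_compl_add_sum, sum_lamb n hn]

/-- In a set with `2h` elements, the number of `h`-subsets containing `a` but not `b` is
the central binomial coefficient `(2h-2 choose h-1)`. -/
theorem card_powersetCard_filter_mem_notMem {ι : Type*} [Fintype ι] [DecidableEq ι]
    {k : ℕ} (hcard : Fintype.card ι = 2 * (k + 1)) {a b : ι} (hab : a ≠ b) :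
    ((Finset.powersetCard (k + 1) (Finset.univ : Finset ι)).filter
      (fun T => a ∈ T ∧ b ∉ T)).card = k.centralBinom := by
  have hcompl : ({a, b}ᶜ : Finset ι).card = 2 * k := by
    rw [Finset.card_compl, hcard, Finset.card_pair hab]
    lia
  rw [Nat.centralBinom, ← hcompl, ← Finset.card_powersetCard]
  refine Finset.card_bij' (fun T _ => T.erase a) (fun S _ => insert a S) ?_ ?_ ?_ ?_
  · intro T hT
    simp only [Finset.mem_filter, Finset.mem_powersetCard_univ] at hT
    rw [Finset.mem_powersetCard, Finset.card_erase_of_mem hT.2.1, hT.1]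
    refine ⟨fun x hx => ?_, rfl⟩
    have := Finset.mem_erase.mp hx
    simp only [Finset.mem_compl, Finset.mem_insert, Finset.mem_singleton, not_or]
    exact ⟨this.1, fun h => hT.2.2 (h ▸ this.2)⟩
  · intro S hS
    rw [Finset.mem_powersetCard] at hS
    have ha : a ∉ S := fun h => by simpa using hS.1 h
    have hb : b ∉ S := fun h => by simpa using hS.1 h
    simp [Finset.card_insert_of_notMem ha, hS.2, hb, hab.symm]
  · intro T hT
    exact Finset.insert_erase (Finset.mem_filter.mp hT).2.1
  · intro S hS
    have ha : a ∉ S := fun h => by simpa using (Finset.mem_powersetCard.mp hS).1 h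
    exact Finset.erase_insert ha

/-- The product of the `λ̄_T` over the `h`-subsets `T` containing `a` does not depend on `a`. -/
theorem prod_lamT_filter_mem_eq (h : ℕ) (hh : 1 < h) (n : ℕ) (hn : n = 2 * h) (a b : Fin n) :
    ∏ T ∈ (Finset.powersetCard h (Finset.univ : Finset (Fin n))).filter (a ∈ ·), lamT n T =
      ∏ T ∈ (Finset.powersetCard h (Finset.univ : Finset (Fin n))).filter (b ∈ ·), lamT n T := by
  rcases eq_or_ne a b with rfl | hab
  · rfl
  have hsplit : ∀ x y : Fin n,
      ∏ T ∈ (Finset.powersetCard h (Finset.univ : Finset (Fin n))).filter (x ∈ ·), lamT n T =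
        (∏ T ∈ (Finset.powersetCard h (Finset.univ : Finset (Fin n))).filter
            (fun T => x ∈ T ∧ y ∈ T), lamT n T) *
          ∏ T ∈ (Finset.powersetCard h (Finset.univ : Finset (Fin n))).filter
            (fun T => x ∈ T ∧ y ∉ T), lamT n T := fun x y => by
    rw [← Finset.prod_filter_mul_prod_filter_not _ (y ∈ ·), Finset.filter_filter,
      Finset.filter_filter]
  have hcompl : ∏ T ∈ (Finset.powersetCard h (Finset.univ : Finset (Fin n))).filter
        (fun T => b ∈ T ∧ a ∉ T), lamT n T =
      ∏ T ∈ (Finset.powersetCard h (Finset.univ : Finset (Fin n))).filter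
        (fun T => a ∈ T ∧ b ∉ T), -lamT n T := by
    refine Finset.prod_bij' (fun T _ => Tᶜ) (fun T _ => Tᶜ) ?_ ?_ ?_ ?_ ?_
    · intro T hT
      simp only [Finset.mem_filter, Finset.mem_powersetCard_univ, Finset.card_compl,
        Fintype.card_fin, Finset.mem_compl, not_not] at hT ⊢
      exact ⟨by lia, hT.2.symm⟩
    · intro T hT
      simp only [Finset.mem_filter, Finset.mem_powersetCard_univ, Finset.card_compl,
        Fintype.card_fin, Finset.mem_compl, not_not] at hT ⊢
      exact ⟨by lia, hT.2.symm⟩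
    · intro T _
      exact compl_compl T
    · intro T _
      exact compl_compl T
    · intro T _
      rw [lamT_compl n (by lia), neg_neg]
  obtain ⟨k, rfl⟩ : ∃ k, h = k + 1 := ⟨h - 1, by lia⟩
  have heven : Even k.centralBinom :=
    even_iff_two_dvd.mpr (Nat.two_dvd_centralBinom_of_one_le (by lia))
  rw [hsplit a b, hsplit b a, hcompl, Finset.prod_neg,
    card_powersetCard_filter_mem_notMem (by simpa using hn) hab, heven.neg_one_pow, one_mul]
  simp only [and_comm]

/-- for `n = 2h` with `h > 1`, the element
`p_h = ∏_{T ⊆ {1,…,n}, |T| = h, 1 ∈ T} λ̄_T` of `Aₙ` is invariant under the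
`Sₙ`-action permuting `λ̄₁,…,λ̄ₙ`. -/
theorem stmt10 (h : ℕ) (hh : 1 < h) (n : ℕ) (hn : n = 2 * h)
    (σ : Equiv.Perm (Fin n)) :
    permAct n σ
        (∏ T ∈ (Finset.powersetCard h (Finset.univ : Finset (Fin n))).filter
          (fun T => ∃ i : Fin n, i ∈ T ∧ (i : ℕ) = 0), lamT n T) =
      ∏ T ∈ (Finset.powersetCard h (Finset.univ : Finset (Fin n))).filter
          (fun T => ∃ i : Fin n, i ∈ T ∧ (i : ℕ) = 0), lamT n T := by
  have hpos : 0 < n := by lia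
  have hzero : ∀ T : Finset (Fin n),
      (∃ i : Fin n, i ∈ T ∧ (i : ℕ) = 0) ↔ (⟨0, hpos⟩ : Fin n) ∈ T := fun T =>
    ⟨fun ⟨i, hi, h0⟩ => (Fin.ext h0 : i = ⟨0, hpos⟩) ▸ hi, fun hT => ⟨_, hT, rfl⟩⟩
  simp only [hzero]
  rw [map_prod, ← prod_lamT_filter_mem_eq h hh n hn (σ ⟨0, hpos⟩) ⟨0, hpos⟩]
  refine Finset.prod_equiv σ.finsetCongr ?_ ?_
  · intro T
    simp
  · intro T _
    exact permAct_lamT n hpos σ T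
end
end
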